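/- Let (Ω, F, P) be a probability space, (X_n) and (Y_n) sequences of real-valued random variables, and 0 < α ≤ 1, 0 < β ≤ 1. If X_n →^{PS^α} X and Y_n →^{PS^β} Y, then X_n + Y_n →^{PS^{max(α,β)}} X + Y. -/

import Mathlib

open MeasureTheory Filter Finset

/-- `P(|X - Y| ≥ ε)` as a real number. -/
noncomputable def probGe {Ω : Type*} [MeasurableSpace Ω] (μ : Measure Ω)
    (X Y : Ω → ℝ) (ε : ℝ) : ℝ :=
  (μ {ω | ε ≤ |X ω - Y ω|}).toReal

open scoped Classical in
/-- Statistical convergence of order `α` in probability of a sequence of random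
variables `X` to a random variable `L`:
for every `ε > 0` and `δ > 0`, `(1/n^α)·|{k ≤ n : P(|X_k − L| ≥ ε) ≥ δ}| → 0`. -/
noncomputable def StatConvProb {Ω : Type*} [MeasurableSpace Ω] (μ : Measure Ω)
    (α : ℝ) (X : ℕ → Ω → ℝ) (L : Ω → ℝ) : Prop :=
  ∀ ε > (0 : ℝ), ∀ δ > (0 : ℝ),
    Tendsto (fun n : ℕ =>
        (((Finset.Icc 1 n).filter fun k => δ ≤ probGe μ (X k) L ε).card : ℝ) / (n : ℝ) ^ α)
      atTop (nhds 0)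

/-- Union bound: `P(|X + Y - (X' + Y')| ≥ ε) ≤ P(|X - X'| ≥ ε / 2) + P(|Y - Y'| ≥ ε / 2)`. -/
theorem probGe_add_le {Ω : Type*} [MeasurableSpace Ω] (μ : Measure Ω) [IsFiniteMeasure μ]
    (X Y X' Y' : Ω → ℝ) (ε : ℝ) :
    probGe μ (fun ω => X ω + Y ω) (fun ω => X' ω + Y' ω) ε ≤
      probGe μ X X' (ε / 2) + probGe μ Y Y' (ε / 2) := by
  refine (measureReal_mono (μ := μ) fun ω hω => ?_).trans (measureReal_union_le _ _)
  simp only [Set.mem_ofPred_eq, Set.mem_union] at hω ⊢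
  by_contra! h
  have := abs_add_le (X ω - X' ω) (Y ω - Y' ω)
  rw [add_sub_add_comm] at hω
  linarith

/-- Statistical convergence of order `α` in probability implies that of any larger order. -/
theorem StatConvProb.mono {Ω : Type*} [MeasurableSpace Ω] {μ : Measure Ω} {α γ : ℝ}
    {X : ℕ → Ω → ℝ} {L : Ω → ℝ} (h : StatConvProb μ α X L) (hαγ : α ≤ γ) :
    StatConvProb μ γ X L := by
  intro ε hε δ hδ
  refine squeeze_zero' (.of_forall fun n => by positivity) ?_ (h ε hε δ hδ)
  filter_upwards [eventually_ge_atTop 1] with n hn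
  have hn' : (1 : ℝ) ≤ n := by exact_mod_cast hn
  gcongr

/-- If `X_n →^{PS^α} X` and `Y_n →^{PS^β} Y` then
`X_n + Y_n →^{PS^{max(α,β)}} X + Y`. -/
theorem statConvProb_add
    {Ω : Type*} [MeasurableSpace Ω] (μ : Measure Ω) [IsProbabilityMeasure μ]
    (α β : ℝ) (hα0 : 0 < α) (hα1 : α ≤ 1) (hβ0 : 0 < β) (hβ1 : β ≤ 1)
    (X Y : ℕ → Ω → ℝ) (Xl Yl : Ω → ℝ)
    (hXmeas : ∀ n, Measurable (X n)) (hYmeas : ∀ n, Measurable (Y n))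
    (hXlmeas : Measurable Xl) (hYlmeas : Measurable Yl)
    (hX : StatConvProb μ α X Xl) (hY : StatConvProb μ β Y Yl) :
    StatConvProb μ (max α β) (fun n ω => X n ω + Y n ω) (fun ω => Xl ω + Yl ω) := by
  classical
  intro ε hε δ hδ
  have hsum := ((hX.mono (le_max_left α β)) (ε / 2) (half_pos hε) (δ / 2) (half_pos hδ)).add
    ((hY.mono (le_max_right α β)) (ε / 2) (half_pos hε) (δ / 2) (half_pos hδ))
  rw [add_zero] at hsum
  refine squeeze_zero (fun n => by positivity) (fun n => ?_) hsum
  rw [← add_div, ← Nat.cast_add]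
  gcongr
  refine (card_le_card fun k hk => ?_).trans (card_union_le _ _)
  simp only [mem_union, mem_filter] at hk ⊢
  have := probGe_add_le μ (X k) (Y k) Xl Yl ε
  by_contra! h
  linarith [h.1 hk.1, h.2 hk.1, hk.2]
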